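/- The function g is continuously differentiable on 𝕄²ˣ²_sym, its gradient Dg is Lipschitz continuous, and for every ξ ∈ 𝕄²ˣ²_sym one has Dg(ξ) = K₀(tr ξ)Id + 2μξ_D if 2μ|ξ_D| + 2αK₀·tr ξ ≤ κ, and Dg(ξ) = (κ/(2α))Id + 2β(|ξ_D| − (tr ξ)/(2α) + κ/(4α²K₀))₊ · (ξ_D/|ξ_D| − (1/(2α))Id) if 2μ|ξ_D| + 2αK₀·tr ξ > κ. -/

import Mathlib

open Matrix Set
open scoped Classical

attribute [local instance] Matrix.frobeniusNormedAddCommGroup Matrix.frobeniusNormedSpace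

noncomputable section

/-- The space of real 2×2 matrices (symmetric ones are singled out by `Matrix.IsSymm`). -/
abbrev M2 : Type := Matrix (Fin 2) (Fin 2) ℝ

/-- Frobenius inner product `A : B = tr (Aᵀ B)`. -/
def inn (A B : M2) : ℝ := (Aᵀ * B).trace

/-- Frobenius norm `|A| = √(A : A)`. -/
def fnorm (A : M2) : ℝ := Real.sqrt (inn A A)

/-- Deviatoric part `A_D = A − (tr A / 2) Id`. -/
def dev (A : M2) : M2 := A - (A.trace / 2) • (1 : M2)

/-- The set of symmetric matrices `𝕄²ˣ²_sym`. -/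
def Msym : Set M2 := {A | A.IsSymm}

/-- The Drucker–Prager elasticity set `K = {σ ∈ 𝕄²ˣ²_sym : |σ_D| + α tr σ ≤ κ}`. -/
def Kset (α κ : ℝ) : Set M2 :=
  {σ | σ.IsSymm ∧ fnorm (dev σ) + α * σ.trace ≤ κ}

/-- The isotropic elasticity tensor `ℂ e = λ (tr e) Id + 2 μ e`. -/
def Cc (lam mu : ℝ) (e : M2) : M2 := (lam * e.trace) • (1 : M2) + (2 * mu) • e

/-- The inverse elasticity tensor `ℂ⁻¹ σ = (tr σ / (4 K₀)) Id + (1/(2μ)) σ_D`, `K₀ = λ + μ`. -/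
def Cinv (lam mu : ℝ) (σ : M2) : M2 :=
  (σ.trace / (4 * (lam + mu))) • (1 : M2) + (1 / (2 * mu)) • dev σ

/-- The constant `β = (1/μ + 1/(2 α² K₀))⁻¹`. -/
def betaC (α lam mu : ℝ) : ℝ := (1 / mu + 1 / (2 * α ^ 2 * (lam + mu)))⁻¹

/-- The function `g`. -/
def gfun (α κ lam mu : ℝ) (ξ : M2) : ℝ :=
  if 2 * mu * fnorm (dev ξ) + 2 * α * (lam + mu) * ξ.trace ≤ κ then
    ((lam + mu) / 2) * ξ.trace ^ 2 + mu * fnorm (dev ξ) ^ 2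
  else
    κ * ξ.trace / (2 * α) - κ ^ 2 / (8 * α ^ 2 * (lam + mu)) +
      betaC α lam mu *
        max (fnorm (dev ξ) - ξ.trace / (2 * α) + κ / (4 * α ^ 2 * (lam + mu))) 0 ^ 2

/-- The (matrix representing the) differential of `g`. -/
def Dg (α κ lam mu : ℝ) (ξ : M2) : M2 :=
  if 2 * mu * fnorm (dev ξ) + 2 * α * (lam + mu) * ξ.trace ≤ κ then
    ((lam + mu) * ξ.trace) • (1 : M2) + (2 * mu) • dev ξ
  else
    (κ / (2 * α)) • (1 : M2) +
      (2 * betaC α lam mu *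
          max (fnorm (dev ξ) - ξ.trace / (2 * α) + κ / (4 * α ^ 2 * (lam + mu))) 0) •
        ((fnorm (dev ξ))⁻¹ • dev ξ - (1 / (2 * α)) • (1 : M2))

/-- The open cone `𝒜₁ = {ξ ∈ 𝕄²ˣ²_sym : μ |ξ_D| + α K₀ tr ξ < 0}`. -/
def A1 (α lam mu : ℝ) : Set M2 :=
  {ξ | ξ.IsSymm ∧ mu * fnorm (dev ξ) + α * (lam + mu) * ξ.trace < 0}

/-- The open cone `𝒜₂ = {ξ ∈ 𝕄²ˣ²_sym : |ξ_D| < tr ξ / (2α)}`. -/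
def A2 (α : ℝ) : Set M2 :=
  {ξ | ξ.IsSymm ∧ fnorm (dev ξ) < ξ.trace / (2 * α)}

/-- The cone `𝒜₃ = 𝕄²ˣ²_sym ∖ (cl 𝒜₁ ∪ cl 𝒜₂)`. -/
def A3 (α lam mu : ℝ) : Set M2 :=
  Msym \ (closure (A1 α lam mu) ∪ closure (A2 α))

/-- The function `G(ξ) = Dg(ξ + (κ/(4αK₀)) Id)`, given by its explicit piecewise expression. -/
def Gfun (α κ lam mu : ℝ) (ξ : M2) : M2 :=
  if ξ ∈ A1 α lam mu then
    (κ / (2 * α)) • (1 : M2) + ((lam + mu) * ξ.trace) • (1 : M2) + (2 * mu) • dev ξ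
  else if ξ ∈ A2 α ∨ ξ = 0 then
    (κ / (2 * α)) • (1 : M2)
  else
    (κ / (2 * α)) • (1 : M2) +
      (2 * betaC α lam mu * (fnorm (dev ξ) - ξ.trace / (2 * α))) •
        ((fnorm (dev ξ))⁻¹ • dev ξ - (1 / (2 * α)) • (1 : M2))

/-- The map `𝒢(ξ, η)`. -/
def calG (α lam mu : ℝ) (ξ η : M2) : M2 :=
  if ξ ∈ A1 α lam mu then
    ((lam + mu) * η.trace) • (1 : M2) + (2 * mu) • dev η
  else if ξ ∈ A2 α ∨ ξ = 0 then
    0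
  else
    (2 * betaC α lam mu * (inn (dev ξ) (dev η) / fnorm (dev ξ) - η.trace / (2 * α))) •
      ((fnorm (dev ξ))⁻¹ • dev ξ - (1 / (2 * α)) • (1 : M2)) +
    (2 * betaC α lam mu * (fnorm (dev ξ) - ξ.trace / (2 * α)) * (fnorm (dev ξ))⁻¹) •
      (dev η - (inn (dev ξ) (dev η) / fnorm (dev ξ) ^ 2) • dev ξ)

/-- The relative boundary `∂𝒜₁` of `𝒜₁` inside `𝕄²ˣ²_sym`. -/
def bdryA1 (α lam mu : ℝ) : Set M2 := closure (A1 α lam mu) \ A1 α lam mu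

/-- The relative boundary `∂𝒜₂` of `𝒜₂` inside `𝕄²ˣ²_sym`. -/
def bdryA2 (α : ℝ) : Set M2 := closure (A2 α) \ A2 α

/-- The outward normal `ν(σ) = μ σ_D/|σ_D| + α K₀ Id` for `σ ∈ ∂𝒜₁ ∖ {0}`. -/
def nu1 (α lam mu : ℝ) (σ : M2) : M2 :=
  (mu * (fnorm (dev σ))⁻¹) • dev σ + (α * (lam + mu)) • (1 : M2)

/-- The outward normal `ν(σ) = σ_D/|σ_D| − (1/(2α)) Id` for `σ ∈ ∂𝒜₂ ∖ {0}`. -/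
def nu2 (α : ℝ) (σ : M2) : M2 :=
  (fnorm (dev σ))⁻¹ • dev σ - (1 / (2 * α)) • (1 : M2)

theorem inn_eq (A B : M2) :
    inn A B = A 0 0 * B 0 0 + A 0 1 * B 0 1 + A 1 0 * B 1 0 + A 1 1 * B 1 1 := by
  simp [inn, Matrix.trace, Matrix.mul_apply, Fin.sum_univ_two]
  ring

theorem inn_self_nonneg (A : M2) : 0 ≤ inn A A := by
  rw [inn_eq]
  nlinarith [sq_nonneg (A 0 0), sq_nonneg (A 0 1), sq_nonneg (A 1 0), sq_nonneg (A 1 1)]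

theorem fnorm_nonneg (A : M2) : 0 ≤ fnorm A := Real.sqrt_nonneg _

theorem fnorm_sq (A : M2) : fnorm A ^ 2 = inn A A := Real.sq_sqrt (inn_self_nonneg A)

theorem norm_eq_fnorm (A : M2) : ‖A‖ = fnorm A := by
  rw [Matrix.frobenius_norm_def, fnorm, Real.sqrt_eq_rpow, inn_eq]
  congr 1
  simp [Fin.sum_univ_two]
  ring

theorem inn_le_fnorm_mul_fnorm (A B : M2) : inn A B ≤ fnorm A * fnorm B := by
  refine le_of_sq_le_sq ?_ (mul_nonneg (fnorm_nonneg A) (fnorm_nonneg B))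
  rw [mul_pow, fnorm_sq, fnorm_sq, inn_eq, inn_eq, inn_eq]
  nlinarith [sq_nonneg (A 0 0 * B 0 1 - A 0 1 * B 0 0), sq_nonneg (A 0 0 * B 1 0 - A 1 0 * B 0 0),
    sq_nonneg (A 0 0 * B 1 1 - A 1 1 * B 0 0), sq_nonneg (A 0 1 * B 1 0 - A 1 0 * B 0 1),
    sq_nonneg (A 0 1 * B 1 1 - A 1 1 * B 0 1), sq_nonneg (A 1 0 * B 1 1 - A 1 1 * B 1 0)]

theorem fnorm_smul {c : ℝ} (hc : 0 ≤ c) (A : M2) : fnorm (c • A) = c * fnorm A := by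
  rw [← norm_eq_fnorm, ← norm_eq_fnorm, norm_smul, Real.norm_of_nonneg hc]

theorem trace_smul_one_add_smul_dev (a b : ℝ) (ξ : M2) :
    (a • (1 : M2) + b • dev ξ).trace = 2 * a := by
  simp [dev, Matrix.trace, Fin.sum_univ_two]
  ring

theorem dev_smul_one_add_smul_dev (a b : ℝ) (ξ : M2) :
    dev (a • (1 : M2) + b • dev ξ) = b • dev ξ := by
  rw [dev, trace_smul_one_add_smul_dev]
  module

/-- The scalar content of the three cases in the definition of `Dg`: the stress has the form
`a Id + b ξ_D`, it is admissible, it realises `g ξ` as the value of the conjugate, and it is the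
energy projection of the elastic stress. -/
theorem exists_Dg_eq {α lam mu : ℝ} (κ : ℝ) (hα : 0 < α) (hmu : 0 < mu)
    (hlm : 0 < lam + mu) (ξ : M2) :
    ∃ a b : ℝ, Dg α κ lam mu ξ = a • (1 : M2) + b • dev ξ ∧ 0 ≤ b ∧
      b * fnorm (dev ξ) + α * (2 * a) ≤ κ ∧
      gfun α κ lam mu ξ = a * ξ.trace + b * fnorm (dev ξ) ^ 2 -
        (a ^ 2 / (lam + mu) + b ^ 2 * fnorm (dev ξ) ^ 2 / (2 * mu)) / 2 ∧
      ∀ m w t : ℝ, 0 ≤ w → m ≤ fnorm (dev ξ) * w → w + α * t ≤ κ →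
        (ξ.trace / 2 - a / (2 * (lam + mu))) * (t - 2 * a) +
          (1 - b / (2 * mu)) * (m - b * fnorm (dev ξ) ^ 2) ≤ 0 := by
  have hr := fnorm_nonneg (dev ξ)
  unfold Dg gfun
  set r := fnorm (dev ξ)
  set s := ξ.trace
  set K := lam + mu
  split_ifs with h
  · refine ⟨K * s, 2 * mu, rfl, by positivity, by linarith, by field_simp; ring, ?_⟩
    intro m w t _ _ _
    apply le_of_eq
    field_simp
    ring
  push Not at h
  obtain hp | hp := le_total (r - s / (2 * α) + κ / (4 * α ^ 2 * K)) 0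
  · rw [max_eq_right hp]
    refine ⟨κ / (2 * α), 0, by simp, le_rfl, le_of_eq (by field_simp; ring),
      by field_simp; ring, ?_⟩
    intro m w t hw0 hm hw
    have e : (s / 2 - κ / (2 * α) / (2 * K)) * (t - 2 * (κ / (2 * α)))
        = -(s / (2 * α) - κ / (4 * α ^ 2 * K)) * (κ - α * t) := by
      field_simp; ring
    have h1 : r * w ≤ (s / (2 * α) - κ / (4 * α ^ 2 * K)) * (κ - α * t) :=
      mul_le_mul (by linarith) (by linarith) hw0 (by linarith)
    rw [e]
    simp only [zero_div, sub_zero, one_mul, zero_mul]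
    linarith
  · rw [max_eq_left hp]
    set p := r - s / (2 * α) + κ / (4 * α ^ 2 * K) with hpdef
    have hr0 : 0 < r := by
      refine lt_of_le_of_ne hr fun h0 => ?_
      rw [← h0] at h hpdef
      have e : 4 * α ^ 2 * K * p = κ - 2 * α * K * s := by
        rw [hpdef]; field_simp; ring
      nlinarith [mul_nonneg (by positivity : 0 ≤ 4 * α ^ 2 * K) hp]
    have hβ : 0 < betaC α lam mu := by unfold betaC; positivity
    have hβp : betaC α lam mu * p * (1 / mu + 1 / (2 * α ^ 2 * K)) = p := by
      unfold betaC
      rw [mul_right_comm, inv_mul_cancel₀ (by positivity), one_mul]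
    generalize betaC α lam mu = β at *
    set q := β * p with hq
    have hq0 : 0 ≤ q := by positivity
    have hqs : s = 2 * α * r + κ / (2 * α * K) - 2 * α * (q * (1 / mu + 1 / (2 * α ^ 2 * K))) := by
      rw [hβp, hpdef]; field_simp; ring
    have hqr : q < mu * r := by
      have e : 2 * mu * r + 2 * α * K * s - κ
          = (mu * r - q) * (2 + 4 * α ^ 2 * K / mu) := by
        rw [hqs]; field_simp; ring
      have h3 : 0 < (mu * r - q) * (2 + 4 * α ^ 2 * K / mu) := by linarith
      linarith [pos_of_mul_pos_left h3 (by positivity)]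
    refine ⟨κ / (2 * α) - q / α, 2 * q / r, ?_, by positivity, le_of_eq ?_, ?_, ?_⟩
    · rw [show 2 * β * p = 2 * q by rw [hq]; ring]
      match_scalars <;> field_simp <;> ring
    · field_simp; ring
    · rw [show β * p ^ 2 = q * p by rw [hq]; ring, ← hβp, hqs]
      field_simp; ring
    · intro m w t hw0 hm hw
      have e : (s / 2 - (κ / (2 * α) - q / α) / (2 * K)) * (t - 2 * (κ / (2 * α) - q / α)) +
          (1 - 2 * q / r / (2 * mu)) * (m - 2 * q / r * r ^ 2)
          = (mu * r - q) / (mu * r) * (m + r * (α * t - κ)) := by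
        rw [hqs]; field_simp; ring
      rw [e]
      refine mul_nonpos_of_nonneg_of_nonpos (div_nonneg (by linarith) (by positivity)) ?_
      nlinarith

theorem Dg_admissible {α lam mu : ℝ} (κ : ℝ) (hα : 0 < α) (hmu : 0 < mu)
    (hlm : 0 < lam + mu) (ξ : M2) :
    fnorm (dev (Dg α κ lam mu ξ)) + α * (Dg α κ lam mu ξ).trace ≤ κ := by
  obtain ⟨a, b, h, hb, hK, -, -⟩ := exists_Dg_eq κ hα hmu hlm ξ
  rwa [h, dev_smul_one_add_smul_dev, trace_smul_one_add_smul_dev, fnorm_smul hb]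

theorem gfun_eq_inn_sub {α lam mu : ℝ} (κ : ℝ) (hα : 0 < α) (hmu : 0 < mu)
    (hlm : 0 < lam + mu) (ξ : M2) :
    gfun α κ lam mu ξ = inn (Dg α κ lam mu ξ) ξ -
      inn (Cinv lam mu (Dg α κ lam mu ξ)) (Dg α κ lam mu ξ) / 2 := by
  obtain ⟨a, b, h, -, -, hg, -⟩ := exists_Dg_eq κ hα hmu hlm ξ
  rw [hg, h, Cinv, dev_smul_one_add_smul_dev, trace_smul_one_add_smul_dev, fnorm_sq]
  simp [inn_eq, dev, Matrix.trace, Fin.sum_univ_two]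
  field_simp
  ring

theorem inn_sub_Cinv_Dg_nonpos {α lam mu : ℝ} (κ : ℝ) (hα : 0 < α) (hmu : 0 < mu)
    (hlm : 0 < lam + mu) (ξ τ : M2) (hτ : fnorm (dev τ) + α * τ.trace ≤ κ) :
    inn (ξ - Cinv lam mu (Dg α κ lam mu ξ)) (τ - Dg α κ lam mu ξ) ≤ 0 := by
  obtain ⟨a, b, h, -, -, -, hv⟩ := exists_Dg_eq κ hα hmu hlm ξ
  refine le_trans (le_of_eq ?_) (hv _ _ _ (fnorm_nonneg (dev τ)) (inn_le_fnorm_mul_fnorm (dev ξ) (dev τ)) hτ)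
  rw [h, Cinv, dev_smul_one_add_smul_dev, trace_smul_one_add_smul_dev, fnorm_sq]
  simp [inn_eq, dev, Matrix.trace, Fin.sum_univ_two]
  field_simp
  ring

theorem inn_Cinv_self (lam mu : ℝ) (σ : M2) :
    inn (Cinv lam mu σ) σ = σ.trace ^ 2 / (4 * (lam + mu)) + fnorm (dev σ) ^ 2 / (2 * mu) := by
  rw [fnorm_sq]
  simp [inn_eq, Cinv, dev, Matrix.trace, Fin.sum_univ_two]
  ring

theorem exists_coercive_Cinv {lam mu : ℝ} (hmu : 0 < mu) (hlm : 0 < lam + mu) :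
    ∃ c : ℝ, 0 < c ∧ ∀ σ : M2, c * fnorm σ ^ 2 ≤ inn (Cinv lam mu σ) σ := by
  refine ⟨min (1 / (2 * (lam + mu))) (1 / (2 * mu)), by positivity, fun σ => ?_⟩
  have e : fnorm σ ^ 2 = σ.trace ^ 2 / 2 + fnorm (dev σ) ^ 2 := by
    rw [fnorm_sq, fnorm_sq]
    simp [inn_eq, dev, Matrix.trace, Fin.sum_univ_two]
    ring
  rw [inn_Cinv_self, e, mul_add]
  have h1 : min (1 / (2 * (lam + mu))) (1 / (2 * mu)) * (σ.trace ^ 2 / 2) ≤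
      1 / (2 * (lam + mu)) * (σ.trace ^ 2 / 2) := by
    gcongr; exact min_le_left _ _
  have h2 : min (1 / (2 * (lam + mu))) (1 / (2 * mu)) * fnorm (dev σ) ^ 2 ≤
      1 / (2 * mu) * fnorm (dev σ) ^ 2 := by
    gcongr; exact min_le_right _ _
  refine (add_le_add h1 h2).trans (le_of_eq ?_)
  field_simp
  ring

theorem half_inn_Cinv_le_gfun_sub {α lam mu : ℝ} (κ : ℝ) (hα : 0 < α) (hmu : 0 < mu)
    (hlm : 0 < lam + mu) (ξ η : M2) :
    inn (Cinv lam mu (Dg α κ lam mu η - Dg α κ lam mu ξ))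
        (Dg α κ lam mu η - Dg α κ lam mu ξ) / 2 ≤
      gfun α κ lam mu η - gfun α κ lam mu ξ - inn (Dg α κ lam mu ξ) (η - ξ) := by
  have h := inn_sub_Cinv_Dg_nonpos κ hα hmu hlm η _ (Dg_admissible κ hα hmu hlm ξ)
  rw [gfun_eq_inn_sub κ hα hmu hlm η, gfun_eq_inn_sub κ hα hmu hlm ξ]
  generalize Dg α κ lam mu ξ = σ at *
  generalize Dg α κ lam mu η = τ at *
  rw [← sub_nonneg]
  refine (neg_nonneg.2 h).trans_eq ?_
  simp [inn_eq, Cinv, dev, Matrix.trace, Fin.sum_univ_two]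
  ring

theorem inn_sub_left (A B C : M2) : inn (A - B) C = inn A C - inn B C := by
  simp [inn_eq]; ring

theorem inn_sub_right (A B C : M2) : inn A (B - C) = inn A B - inn A C := by
  simp [inn_eq]; ring

theorem exists_lipschitz_Dg {α lam mu : ℝ} (κ : ℝ) (hα : 0 < α) (hmu : 0 < mu)
    (hlm : 0 < lam + mu) :
    ∃ C : ℝ, 0 ≤ C ∧ ∀ ξ η : M2,
      fnorm (Dg α κ lam mu ξ - Dg α κ lam mu η) ≤ C * fnorm (ξ - η) := by
  obtain ⟨c, hc, hcoer⟩ := exists_coercive_Cinv hmu hlm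
  refine ⟨c⁻¹, by positivity, fun ξ η => ?_⟩
  have h1 := half_inn_Cinv_le_gfun_sub κ hα hmu hlm ξ η
  have h2 := half_inn_Cinv_le_gfun_sub κ hα hmu hlm η ξ
  have h3 := hcoer (Dg α κ lam mu ξ - Dg α κ lam mu η)
  have h4 := hcoer (Dg α κ lam mu η - Dg α κ lam mu ξ)
  have h5 := inn_le_fnorm_mul_fnorm (Dg α κ lam mu ξ - Dg α κ lam mu η) (ξ - η)
  rw [← norm_eq_fnorm, norm_sub_rev, norm_eq_fnorm] at h4
  simp only [inn_sub_left, inn_sub_right] at h1 h2 h3 h4 h5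
  have h6 : c * fnorm (Dg α κ lam mu ξ - Dg α κ lam mu η) ^ 2 ≤
      fnorm (Dg α κ lam mu ξ - Dg α κ lam mu η) * fnorm (ξ - η) := by linarith
  rw [← div_eq_inv_mul, le_div_iff₀ hc]
  obtain h0 | h0 := (fnorm_nonneg (Dg α κ lam mu ξ - Dg α κ lam mu η)).eq_or_lt
  · rw [← h0]; simpa using fnorm_nonneg (ξ - η)
  · nlinarith

/-- `A ↦ (B ↦ A : B)` as a continuous linear map. -/
def innCLM : M2 →L[ℝ] M2 →L[ℝ] ℝ :=
  LinearMap.toContinuousLinearMap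
    ((LinearMap.toContinuousLinearMap (𝕜 := ℝ) (E := M2) (F' := ℝ)).toLinearMap ∘ₗ
      LinearMap.mk₂ ℝ inn
        (fun _ _ _ => by simp [inn_eq]; ring) (fun _ _ _ => by simp [inn_eq]; ring)
        (fun _ _ _ => by simp [inn_eq]; ring) (fun _ _ _ => by simp [inn_eq]; ring))

theorem innCLM_apply (A B : M2) : innCLM A B = inn A B := rfl

theorem hasFDerivAt_gfun {α lam mu : ℝ} (κ : ℝ) (hα : 0 < α) (hmu : 0 < mu)
    (hlm : 0 < lam + mu) (ξ : M2) :
    HasFDerivAt (gfun α κ lam mu) (innCLM (Dg α κ lam mu ξ)) ξ := by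
  obtain ⟨C, hC, hL⟩ := exists_lipschitz_Dg κ hα hmu hlm
  obtain ⟨c, hc, hcoer⟩ := exists_coercive_Cinv hmu hlm
  refine .of_isLittleO ?_
  refine (Asymptotics.IsBigO.of_bound C (g := fun η => ‖η - ξ‖ ^ 2)
    (Filter.Eventually.of_forall fun η => ?_)).trans_isLittleO
      (Asymptotics.isLittleO_pow_sub_sub ξ one_lt_two)
  change ‖gfun α κ lam mu η - gfun α κ lam mu ξ - inn (Dg α κ lam mu ξ) (η - ξ)‖ ≤
    C * ‖‖η - ξ‖ ^ 2‖
  rw [norm_pow, norm_norm, norm_eq_fnorm]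
  have h1 := half_inn_Cinv_le_gfun_sub κ hα hmu hlm ξ η
  have h2 := half_inn_Cinv_le_gfun_sub κ hα hmu hlm η ξ
  have h3 := (mul_nonneg hc.le (sq_nonneg _)).trans (hcoer (Dg α κ lam mu ξ - Dg α κ lam mu η))
  have h4 := (mul_nonneg hc.le (sq_nonneg _)).trans (hcoer (Dg α κ lam mu η - Dg α κ lam mu ξ))
  have h5 := inn_le_fnorm_mul_fnorm (Dg α κ lam mu η - Dg α κ lam mu ξ) (η - ξ)
  have h6 := mul_le_mul_of_nonneg_right (hL η ξ) (fnorm_nonneg (η - ξ))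
  rw [Real.norm_of_nonneg (by linarith)]
  simp only [inn_sub_left, inn_sub_right] at *
  nlinarith

theorem contDiff_gfun {α lam mu : ℝ} (κ : ℝ) (hα : 0 < α) (hmu : 0 < mu)
    (hlm : 0 < lam + mu) : ContDiff ℝ 1 (gfun α κ lam mu) := by
  obtain ⟨C, hC, hL⟩ := exists_lipschitz_Dg κ hα hmu hlm
  have hcont : Continuous (Dg α κ lam mu) := by
    refine (LipschitzWith.of_dist_le_mul (K := ⟨C, hC⟩) fun ξ η => ?_).continuous
    rw [dist_eq_norm, dist_eq_norm, norm_eq_fnorm, norm_eq_fnorm]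
    exact hL ξ η
  rw [contDiff_one_iff_fderiv]
  refine ⟨fun ξ => (hasFDerivAt_gfun κ hα hmu hlm ξ).differentiableAt, ?_⟩
  exact (innCLM.continuous.comp hcont).congr fun ξ =>
    (hasFDerivAt_gfun κ hα hmu hlm ξ).fderiv.symm

/-- `g` is `C¹` on `𝕄²ˣ²_sym`, its gradient is the explicitly given `Dg`,
and `Dg` is Lipschitz continuous. -/
theorem stmt_7 (α κ lam mu : ℝ) (hα : 0 < α) (hκ : 0 < κ) (hmu : 0 < mu)
    (hlm : 0 < lam + mu) :
    ContDiffOn ℝ 1 (gfun α κ lam mu) Msym ∧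
    (∀ ξ ∈ Msym, ∃ L : M2 →L[ℝ] ℝ,
      HasFDerivWithinAt (gfun α κ lam mu) L Msym ξ ∧
      ∀ η : M2, L η = inn (Dg α κ lam mu ξ) η) ∧
    (∃ C : ℝ, ∀ ξ ∈ Msym, ∀ ζ ∈ Msym,
      fnorm (Dg α κ lam mu ξ - Dg α κ lam mu ζ) ≤ C * fnorm (ξ - ζ)) := by
  obtain ⟨C, -, hL⟩ := exists_lipschitz_Dg κ hα hmu hlm
  exact ⟨(contDiff_gfun κ hα hmu hlm).contDiffOn,
    fun ξ _ => ⟨innCLM (Dg α κ lam mu ξ), (hasFDerivAt_gfun κ hα hmu hlm ξ).hasFDerivWithinAt,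
      innCLM_apply _⟩,
    C, fun ξ _ ζ _ => hL ξ ζ⟩
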